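/- The predicate (∃ l m, RQ(l,m)) ∨ (∃ k, RP(k)) is closed in the program PIF: if a state st satisfies RQ(l,m) for some 0 ≤ l < m ≤ N or RP(k) for some 1 ≤ k ≤ N−1, then the state resulting from the execution of any enabled PIF action again satisfies RQ(l',m') for some l',m' or RP(k') for some k'. -/

import Mathlib

/-- Values of the state variable of a PIF process: idle, requesting, replying. -/
inductive PSt where
  | idle | rq | rp
deriving DecidableEq

/-- A PIF state on the chain of `N` processes is valid if the root (process 1)
never holds `rp` and the leaf (process `N`) never holds `rq`. -/
def PifValid (N : ℕ) (st : ℕ → PSt) : Prop := st 1 ≠ PSt.rp ∧ st N ≠ PSt.rq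

/-- One step of the PIF program on the chain of `N` processes: `st'` is
obtained from `st` by executing one enabled action (request, clear, forward,
back, stop, reflect or reset). -/
def pifStep (N : ℕ) (st st' : ℕ → PSt) : Prop :=
  -- request (root)
  (st 1 = PSt.idle ∧ st 2 = PSt.idle ∧ st' = Function.update st 1 PSt.rq) ∨
  -- clear (root)
  (st 1 = PSt.rq ∧ st 2 = PSt.rp ∧ st' = Function.update st 1 PSt.idle) ∨
  -- forward (intermediate)
  (∃ j, 2 ≤ j ∧ j ≤ N - 1 ∧ st (j - 1) = PSt.rq ∧ st j = PSt.idle ∧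
    st (j + 1) = PSt.idle ∧ st' = Function.update st j PSt.rq) ∨
  -- back (intermediate)
  (∃ j, 2 ≤ j ∧ j ≤ N - 1 ∧ st (j - 1) = PSt.rq ∧ st j = PSt.rq ∧
    st (j + 1) = PSt.rp ∧ st' = Function.update st j PSt.rp) ∨
  -- stop (intermediate)
  (∃ j, 2 ≤ j ∧ j ≤ N - 1 ∧ st (j - 1) = PSt.idle ∧ st j ≠ PSt.idle ∧
    st' = Function.update st j PSt.idle) ∨
  -- reflect (leaf)
  (st (N - 1) = PSt.rq ∧ st N = PSt.idle ∧ st' = Function.update st N PSt.rp) ∨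
  -- reset (leaf)
  (st (N - 1) = PSt.idle ∧ st N = PSt.rp ∧ st' = Function.update st N PSt.idle)

/-- `RP N k st`: the `k` leftmost processes are requesting and the rest are
replying (`1 ≤ k ≤ N - 1`). -/
def RP (N k : ℕ) (st : ℕ → PSt) : Prop :=
  1 ≤ k ∧ k ≤ N - 1 ∧
  (∀ j, 1 ≤ j → j ≤ k → st j = PSt.rq) ∧
  (∀ j, k < j → j ≤ N → st j = PSt.rp)

/-- `RQ N l m st`: the `l` leftmost processes are requesting, processes
`l+1 .. m` are idle, and the rest are replying (`0 ≤ l < m ≤ N`). -/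
def RQ (N l m : ℕ) (st : ℕ → PSt) : Prop :=
  l < m ∧ m ≤ N ∧
  (∀ j, 1 ≤ j → j ≤ l → st j = PSt.rq) ∧
  (∀ j, l < j → j ≤ m → st j = PSt.idle) ∧
  (∀ j, m < j → j ≤ N → st j = PSt.rp)

/-- `RP' N k st`: the `k` leftmost processes are requesting, process `k+1` is
replying, and no process beyond `k+1` is idle (`1 ≤ k ≤ N - 1`). -/
def RP' (N k : ℕ) (st : ℕ → PSt) : Prop :=
  1 ≤ k ∧ k ≤ N - 1 ∧
  (∀ j, 1 ≤ j → j ≤ k → st j = PSt.rq) ∧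
  st (k + 1) = PSt.rp ∧
  (∀ j, k + 1 < j → j ≤ N → st j ≠ PSt.idle)

/-- `RQ' N l m st`: the `l` leftmost processes are requesting, processes
`l+1 .. m` are idle, and the remaining processes are arbitrary
(`0 ≤ l < m ≤ N`). -/
def RQ' (N l m : ℕ) (st : ℕ → PSt) : Prop :=
  l < m ∧ m ≤ N ∧
  (∀ j, 1 ≤ j → j ≤ l → st j = PSt.rq) ∧
  (∀ j, l < j → j ≤ m → st j = PSt.idle)

theorem RQ_inv {N l m : ℕ} {st : ℕ → PSt} (h : RQ N l m st) (j : ℕ) (h1 : 1 ≤ j) (h2 : j ≤ N) :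
    (j ≤ l ∧ st j = PSt.rq) ∨ (l < j ∧ j ≤ m ∧ st j = PSt.idle) ∨ (m < j ∧ st j = PSt.rp) := by
  obtain ⟨_, _, a, b, c⟩ := h
  by_cases x : j ≤ l
  · exact Or.inl ⟨x, a j h1 x⟩
  · by_cases y : j ≤ m
    · exact Or.inr (Or.inl ⟨by omega, y, b j (by omega) y⟩)
    · exact Or.inr (Or.inr ⟨by omega, c j (by omega) h2⟩)

theorem RP_inv {N k : ℕ} {st : ℕ → PSt} (h : RP N k st) (j : ℕ) (h1 : 1 ≤ j) (h2 : j ≤ N) :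
    (j ≤ k ∧ st j = PSt.rq) ∨ (k < j ∧ st j = PSt.rp) := by
  obtain ⟨_, _, a, b⟩ := h
  by_cases x : j ≤ k
  · exact Or.inl ⟨x, a j h1 x⟩
  · exact Or.inr ⟨by omega, b j (by omega) h2⟩

/-- The predicate `(∃ l m, RQ l m) ∨ (∃ k, RP k)` is closed in `PIF`: executing
any enabled action from a state satisfying it yields a state satisfying it. -/
theorem pif_invariant_closed (N : ℕ) (hN : 3 ≤ N)
    (st st' : ℕ → PSt) (hv : PifValid N st)
    (h : (∃ l m, RQ N l m st) ∨ (∃ k, RP N k st))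
    (hstep : pifStep N st st') :
    (∃ l m, RQ N l m st') ∨ (∃ k, RP N k st') := by
  clear hv
  rcases h with ⟨l, m, h⟩ | ⟨k, h⟩
  · have inv := RQ_inv h
    obtain ⟨hlm, hm, -, -, -⟩ := h
    rcases hstep with ⟨a, b, rfl⟩ | ⟨a, b, rfl⟩ | ⟨j, h1, h2, a, b, c, rfl⟩ |
      ⟨j, h1, h2, a, b, c, rfl⟩ | ⟨j, h1, h2, a, b, rfl⟩ | ⟨a, b, rfl⟩ | ⟨a, b, rfl⟩
    · have i1 := inv 1 (by omega) (by omega)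
      have i2 := inv 2 (by omega) (by omega)
      refine Or.inl ⟨1, m, ?_⟩
      unfold RQ
      grind
    · have i1 := inv 1 (by omega) (by omega)
      have i2 := inv 2 (by omega) (by omega)
      grind
    · have i1 := inv (j - 1) (by omega) (by omega)
      have i2 := inv j (by omega) (by omega)
      have i3 := inv (j + 1) (by omega) (by omega)
      refine Or.inl ⟨j, m, ?_⟩
      unfold RQ
      grind
    · have i2 := inv j (by omega) (by omega)
      have i3 := inv (j + 1) (by omega) (by omega)
      grind
    · have i1 := inv (j - 1) (by omega) (by omega)
      have i2 := inv j (by omega) (by omega)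
      refine Or.inl ⟨l, j, ?_⟩
      unfold RQ
      grind
    · have i1 := inv (N - 1) (by omega) (by omega)
      have i2 := inv N (by omega) (by omega)
      refine Or.inr ⟨N - 1, ?_⟩
      unfold RP
      grind
    · have i1 := inv (N - 1) (by omega) (by omega)
      have i2 := inv N (by omega) (by omega)
      refine Or.inl ⟨l, N, ?_⟩
      unfold RQ
      grind
  · have inv := RP_inv h
    obtain ⟨hk, hkN, -, -⟩ := h
    rcases hstep with ⟨a, b, rfl⟩ | ⟨a, b, rfl⟩ | ⟨j, h1, h2, a, b, c, rfl⟩ |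
      ⟨j, h1, h2, a, b, c, rfl⟩ | ⟨j, h1, h2, a, b, rfl⟩ | ⟨a, b, rfl⟩ | ⟨a, b, rfl⟩
    · have i1 := inv 1 (by omega) (by omega)
      grind
    · have i1 := inv 1 (by omega) (by omega)
      have i2 := inv 2 (by omega) (by omega)
      refine Or.inl ⟨0, 1, ?_⟩
      unfold RQ
      grind
    · have i2 := inv j (by omega) (by omega)
      grind
    · have i2 := inv j (by omega) (by omega)
      have i3 := inv (j + 1) (by omega) (by omega)
      refine Or.inr ⟨j - 1, ?_⟩
      unfold RP
      grind
    · have i1 := inv (j - 1) (by omega) (by omega)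
      grind
    · have i2 := inv N (by omega) (by omega)
      grind
    · have i1 := inv (N - 1) (by omega) (by omega)
      grind
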